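/- arXiv:1512.01999 — 2 statements merged into one kernel-verified Lean document; each statement's English description precedes it below -/
import Mathlib

section
/- The convolution operator on ℓ²(ℤ) with kernel K⁺(z) = −(1/π) · 1/(z + 1/2), namely (𝓗⁺f)(x) = −(1/π) Σ_{z∈ℤ} f(x−z)/(z + 1/2), has Fourier multiplier i e^{iπξ} sin(πξ)/|sin(πξ)| for ξ ∈ (−1/2, 1/2), ξ ≠ 0. Equivalently, Σ_{y∈ℤ} −(1/π) · e^{−2πiyξ}/(y + 1/2) = i e^{iπξ} sin(πξ)/|sin(πξ)|. -/
open scoped Real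
open Filter

noncomputable section

/-- Convolution kernel of the right discrete Hilbert transform: `K⁺(z) = -(1/π)·1/(z+1/2)`. -/
def Kplus (z : ℤ) : ℝ := -(1 / π) * (1 / ((z : ℝ) + 1 / 2))

/-- The symbol of the right discrete Hilbert transform `𝓗⁺`:
`m⁺(ξ) = i e^{iπξ} sin(πξ)/|sin(πξ)|`. -/
def mplus (ξ : ℝ) : ℂ :=
  Complex.I * Complex.exp ((π : ℂ) * (ξ : ℂ) * Complex.I) *
    ((Real.sin (π * ξ) / |Real.sin (π * ξ)| : ℝ) : ℂ)

theorem aux_logsum (w : ℂ) (hw : ‖w‖ = 1) (hw1 : w ≠ 1) :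
    Tendsto (fun n : ℕ => ∑ i ∈ Finset.range n, w ^ (i + 1) / ((i : ℂ) + 1)) atTop
      (nhds (-Complex.log (1 - w))) := by
  have hanti : Antitone (fun n : ℕ => 1 / ((n : ℝ) + 1)) := fun a b h => by
    have : (a : ℝ) ≤ b := by exact_mod_cast h
    dsimp only
    gcongr
  have hb : ∀ n, ‖∑ i ∈ Finset.range n, w ^ (i + 1)‖ ≤ 2 / ‖w - 1‖ := by
    intro n
    have h1 : ∑ i ∈ Finset.range n, w ^ (i + 1) = w * ((w ^ n - 1) / (w - 1)) := by
      rw [← geom_sum_eq hw1, Finset.mul_sum]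
      exact Finset.sum_congr rfl fun i _ => by ring
    rw [h1, norm_mul, hw, one_mul, norm_div]
    gcongr
    calc ‖w ^ n - 1‖ ≤ ‖w ^ n‖ + ‖(1 : ℂ)‖ := norm_sub_le _ _
      _ = 2 := by rw [norm_pow, hw]; norm_num
  have hc := hanti.cauchySeq_series_mul_of_tendsto_zero_of_bounded
    tendsto_one_div_add_atTop_nhds_zero_nat hb
  obtain ⟨l, hl⟩ := cauchySeq_tendsto_of_complete hc
  have he : (fun n : ℕ => ∑ i ∈ Finset.range n, (1 / ((i : ℝ) + 1)) • w ^ (i + 1)) =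
      (fun n : ℕ => ∑ i ∈ Finset.range n, w ^ (i + 1) / ((i : ℂ) + 1)) := by
    funext n
    refine Finset.sum_congr rfl fun i _ => ?_
    rw [Complex.real_smul]
    push_cast
    ring
  rw [he] at hl
  have habel := Complex.tendsto_tsum_powerSeries_nhdsWithin_lt hl
  rw [tendsto_map'_iff] at habel
  have hr : Tendsto (fun r : ℝ => (r : ℂ)) (nhdsWithin 1 (Set.Iio 1)) (nhds 1) := by
    have : Tendsto (fun r : ℝ => (r : ℂ)) (nhds 1) (nhds ((1 : ℝ) : ℂ)) :=
      Complex.continuous_ofReal.tendsto 1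
    rw [Complex.ofReal_one] at this
    exact this.mono_left nhdsWithin_le_nhds
  have h2 := hr.mul habel
  rw [one_mul] at h2
  have hslit : 1 - w ∈ Complex.slitPlane := by
    rw [Complex.mem_slitPlane_iff]
    by_contra hcon
    push Not at hcon
    obtain ⟨hre, him⟩ := hcon
    simp at hre him
    have hn : w.re * w.re + w.im * w.im = 1 := by
      have := Complex.normSq_eq_norm_sq w
      rw [hw, Complex.normSq_apply] at this
      simpa using this
    rw [him] at hn
    apply hw1
    apply Complex.ext
    · simp; nlinarith
    · simpa using him
  have h3 : Tendsto (fun r : ℝ => -Complex.log (1 - r * w)) (nhdsWithin 1 (Set.Iio 1))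
      (nhds (-Complex.log (1 - w))) := by
    have h4 : Tendsto (fun r : ℝ => 1 - (r : ℂ) * w) (nhdsWithin 1 (Set.Iio 1))
      (nhds (1 - w)) := by
      have := (hr.mul_const w).const_sub 1
      rwa [one_mul] at this
    exact (h4.clog hslit).neg
  have h5 : l = -Complex.log (1 - w) := by
    refine tendsto_nhds_unique (h2.congr' ?_) h3
    have hpos : ∀ᶠ r : ℝ in nhdsWithin 1 (Set.Iio 1), 0 < r :=
      nhdsWithin_le_nhds (lt_mem_nhds one_pos)
    filter_upwards [hpos, self_mem_nhdsWithin] with r hr0 hr1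
    have hn : ‖(r : ℂ) * w‖ < 1 := by
      rw [norm_mul, hw, mul_one, Complex.norm_real, Real.norm_eq_abs, abs_of_pos hr0]
      exact hr1
    rw [← (Complex.hasSum_taylorSeries_neg_log' hn).tsum_eq, Function.comp, ← tsum_mul_left]
    refine tsum_congr fun n => ?_
    rw [mul_pow]
    ring
  rwa [h5] at hl

theorem aux_odd (w : ℂ) (N : ℕ) :
    (∑ i ∈ Finset.range (2 * N), w ^ (i + 1) / ((i : ℂ) + 1)) -
      (∑ i ∈ Finset.range (2 * N), (-w) ^ (i + 1) / ((i : ℂ) + 1)) =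
      2 * ∑ n ∈ Finset.range N, w ^ (2 * n + 1) / (2 * (n : ℂ) + 1) := by
  induction N with
  | zero => simp
  | succ N ih =>
    rw [show 2 * (N + 1) = 2 * N + 1 + 1 by ring, Finset.sum_range_succ, Finset.sum_range_succ,
      Finset.sum_range_succ _ (2 * N + 1), Finset.sum_range_succ _ (2 * N),
      Finset.sum_range_succ _ N, mul_add, ← ih]
    have e1 : (-w) ^ (2 * N + 1) = -w ^ (2 * N + 1) := Odd.neg_pow ⟨N, rfl⟩ w
    have e2 : (-w) ^ (2 * N + 1 + 1) = w ^ (2 * N + 1 + 1) := Even.neg_pow ⟨N + 1, by ring⟩ w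
    rw [e1, e2]
    push_cast
    ring

theorem aux_arg1 (x : ℝ) (h0 : 0 < x) (h1 : x < π) :
    (Complex.log (1 + Complex.exp (x * Complex.I))).im = x / 2 := by
  have hc : 0 < Real.cos (x / 2) := Real.cos_pos_of_mem_Ioo ⟨by linarith, by linarith⟩
  have : 1 + Complex.exp (x * Complex.I) = ((2 * Real.cos (x / 2) : ℝ) : ℂ) *
      (Complex.cos ((x / 2 : ℝ) : ℂ) + Complex.sin ((x / 2 : ℝ) : ℂ) * Complex.I) := by
    have e : (x : ℝ) = 2 * (x / 2) := by ring
    have h2 := Real.cos_two_mul (x / 2)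
    have h3 := Real.sin_two_mul (x / 2)
    rw [← e] at h2 h3
    rw [Complex.exp_mul_I, ← Complex.ofReal_cos, ← Complex.ofReal_sin, ← Complex.ofReal_cos,
      ← Complex.ofReal_sin, h2, h3]
    push_cast
    ring
  rw [Complex.log_im, this, Complex.arg_mul_cos_add_sin_mul_I (by positivity)
    ⟨by linarith, by linarith⟩]

theorem aux_arg2 (x : ℝ) (h0 : 0 < x) (h1 : x < π) :
    (Complex.log (1 - Complex.exp (x * Complex.I))).im = x / 2 - π / 2 := by
  have hc : 0 < Real.sin (x / 2) := Real.sin_pos_of_pos_of_lt_pi (by linarith) (by linarith)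
  have : 1 - Complex.exp (x * Complex.I) = ((2 * Real.sin (x / 2) : ℝ) : ℂ) *
      (Complex.cos ((x / 2 - π / 2 : ℝ) : ℂ) +
        Complex.sin ((x / 2 - π / 2 : ℝ) : ℂ) * Complex.I) := by
    have e : (x : ℝ) = 2 * (x / 2) := by ring
    have h2 := Real.cos_two_mul (x / 2)
    have h3 := Real.sin_two_mul (x / 2)
    have h4 := Real.sin_sq (x / 2)
    rw [← e] at h2 h3
    have h5 : Real.cos x = 1 - 2 * Real.sin (x / 2) ^ 2 := by linarith
    rw [Complex.exp_mul_I, ← Complex.ofReal_cos, ← Complex.ofReal_sin, ← Complex.ofReal_cos,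
      ← Complex.ofReal_sin, h5, h3, Real.cos_sub_pi_div_two, Real.sin_sub_pi_div_two]
    push_cast
    ring
  rw [Complex.log_im, this, Complex.arg_mul_cos_add_sin_mul_I (by positivity)
    ⟨by linarith, by linarith⟩]

theorem aux_square_pos (x : ℝ) (h0 : 0 < x) (h1 : x < π) :
    Tendsto (fun N : ℕ => ∑ n ∈ Finset.range N, Real.sin ((2 * n + 1) * x) / (2 * (n : ℝ) + 1))
      atTop (nhds (π / 4)) := by
  set w := Complex.exp (x * Complex.I) with hwdef
  have hw : ‖w‖ = 1 := Complex.norm_exp_ofReal_mul_I x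
  have him : w.im = Real.sin x := Complex.exp_ofReal_mul_I_im x
  have hs : 0 < Real.sin x := Real.sin_pos_of_pos_of_lt_pi h0 h1
  have hw1 : w ≠ 1 := fun h => by rw [h] at him; simp at him; linarith
  have hw2 : -w ≠ 1 := fun h => by
    have : (-w).im = 0 := by rw [h]; simp
    rw [Complex.neg_im] at this
    linarith
  have t2 : Tendsto (fun N : ℕ => 2 * N) atTop atTop :=
    tendsto_id.const_mul_atTop' (by norm_num)
  have hA := ((aux_logsum w hw hw1).comp t2).sub
    ((aux_logsum (-w) (by rw [norm_neg, hw]) hw2).comp t2)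
  have hB := (Complex.continuous_im.tendsto _).comp hA
  have hlim : (-Complex.log (1 - w) - -Complex.log (1 - -w)).im = π / 2 := by
    rw [sub_neg_eq_add, sub_neg_eq_add, Complex.add_im, Complex.neg_im, aux_arg1 x h0 h1,
      aux_arg2 x h0 h1]
    ring
  rw [hlim] at hB
  have hC := hB.div_const 2
  rw [show π / 2 / 2 = π / 4 by ring] at hC
  refine hC.congr fun N => ?_
  simp only [Function.comp]
  rw [aux_odd, show (2 : ℂ) = ((2 : ℝ) : ℂ) by norm_num, Complex.im_ofReal_mul, Complex.im_sum,
    mul_div_cancel_left₀ _ two_ne_zero]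
  refine Finset.sum_congr rfl fun n _ => ?_
  rw [hwdef, ← Complex.exp_nat_mul,
    show ((2 * n + 1 : ℕ) : ℂ) * (x * Complex.I) = (((2 * n + 1) * x : ℝ) : ℂ) * Complex.I by
      push_cast; ring,
    show ((2 : ℝ) : ℂ) * (n : ℂ) + 1 = ((2 * n + 1 : ℝ) : ℂ) by push_cast; ring,
    Complex.div_ofReal_im, Complex.exp_ofReal_mul_I_im]

theorem aux_square (x : ℝ) (h0 : x ≠ 0) (hl : -π < x) (h1 : x < π) :
    Tendsto (fun N : ℕ => ∑ n ∈ Finset.range N, Real.sin ((2 * n + 1) * x) / (2 * (n : ℝ) + 1))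
      atTop (nhds (π / 4 * (Real.sin x / |Real.sin x|))) := by
  rcases lt_or_gt_of_ne h0 with h | h
  · have hs : Real.sin x < 0 := Real.sin_neg_of_neg_of_neg_pi_lt h hl
    rw [abs_of_neg hs, div_neg, div_self hs.ne, mul_neg, mul_one]
    refine (aux_square_pos (-x) (by linarith) (by linarith)).neg.congr fun N => ?_
    rw [← Finset.sum_neg_distrib]
    refine Finset.sum_congr rfl fun n _ => ?_
    rw [mul_neg, Real.sin_neg, neg_div, neg_neg]
  · have hs : 0 < Real.sin x := Real.sin_pos_of_pos_of_lt_pi h h1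
    rw [abs_of_pos hs, div_self hs.ne', mul_one]
    exact aux_square_pos x h h1

theorem aux_Icc (f : ℤ → ℂ) (N : ℕ) :
    ∑ y ∈ Finset.Icc (-(N : ℤ)) (N : ℤ), f y =
      (∑ n ∈ Finset.range N, (f n + f (-(n : ℤ) - 1))) + f N := by
  induction N with
  | zero => simp
  | succ N ih =>
    have : Finset.Icc (-((N + 1 : ℕ) : ℤ)) ((N + 1 : ℕ) : ℤ) =
        insert (-(N : ℤ) - 1) (insert ((N : ℤ) + 1) (Finset.Icc (-(N : ℤ)) (N : ℤ))) := by
      ext y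
      simp only [Finset.mem_insert, Finset.mem_Icc]
      omega
    rw [this, Finset.sum_insert (by simp only [Finset.mem_insert, Finset.mem_Icc]; omega),
      Finset.sum_insert (by simp only [Finset.mem_Icc]; omega), ih, Finset.sum_range_succ]
    push_cast
    ring

theorem aux_pair (ξ : ℝ) (n : ℕ) :
    (Kplus n : ℂ) * Complex.exp (-(2 * (π : ℂ) * Complex.I * ((n : ℤ) : ℂ) * (ξ : ℂ))) +
      (Kplus (-(n : ℤ) - 1) : ℂ) *
        Complex.exp (-(2 * (π : ℂ) * Complex.I * ((-(n : ℤ) - 1 : ℤ) : ℂ) * (ξ : ℂ))) =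
    (4 / π * Complex.I * Complex.exp ((π : ℂ) * (ξ : ℂ) * Complex.I)) *
      ((Real.sin ((2 * n + 1) * (π * ξ)) / (2 * (n : ℝ) + 1) : ℝ) : ℂ) := by
  have hp : (π : ℂ) ≠ 0 := by exact_mod_cast Real.pi_ne_zero
  have hn : (2 * (n : ℂ) + 1) ≠ 0 := by exact_mod_cast (by omega : 2 * n + 1 ≠ 0)
  have k1 : (Kplus n : ℂ) = -(2 / (π * (2 * n + 1))) := by
    have : (n : ℂ) + 1 / 2 ≠ 0 := fun h => hn (by linear_combination 2 * h)
    unfold Kplus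
    push_cast
    field_simp
  have k2 : (Kplus (-(n : ℤ) - 1) : ℂ) = 2 / (π * (2 * n + 1)) := by
    have : -(n : ℂ) - 1 + 1 / 2 = -((2 * n + 1) / 2) := by ring
    unfold Kplus
    push_cast
    rw [this]
    field_simp
  have e1 : Complex.exp (-(2 * (π : ℂ) * Complex.I * ((n : ℤ) : ℂ) * (ξ : ℂ))) =
      Complex.exp ((π : ℂ) * (ξ : ℂ) * Complex.I) *
        Complex.exp (-(((2 * n + 1) * (π * ξ) : ℂ)) * Complex.I) := by
    rw [← Complex.exp_add]
    congr 1
    push_cast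
    ring
  have e2 : Complex.exp (-(2 * (π : ℂ) * Complex.I * ((-(n : ℤ) - 1 : ℤ) : ℂ) * (ξ : ℂ))) =
      Complex.exp ((π : ℂ) * (ξ : ℂ) * Complex.I) *
        Complex.exp (((2 * n + 1) * (π * ξ) : ℂ) * Complex.I) := by
    rw [← Complex.exp_add]
    congr 1
    push_cast
    ring
  rw [k1, k2, e1, e2]
  push_cast
  rw [Complex.exp_mul_I, Complex.exp_mul_I (((2 * n + 1) * (π * ξ) : ℂ)), Complex.exp_mul_I,
    Complex.cos_neg, Complex.sin_neg]
  field_simp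
  ring

theorem aux_last (ξ : ℝ) :
    Tendsto (fun N : ℕ => (Kplus N : ℂ) *
      Complex.exp (-(2 * (π : ℂ) * Complex.I * ((N : ℤ) : ℂ) * (ξ : ℂ)))) atTop (nhds 0) := by
  rw [tendsto_zero_iff_norm_tendsto_zero]
  have h := (tendsto_one_div_add_atTop_nhds_zero_nat (𝕜 := ℝ)).const_mul (2 / π)
  rw [mul_zero] at h
  refine squeeze_zero (fun _ => norm_nonneg _) (fun N => ?_) h
  rw [show -(2 * (π : ℂ) * Complex.I * ((N : ℤ) : ℂ) * (ξ : ℂ)) =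
    ((-(2 * π * N * ξ) : ℝ) : ℂ) * Complex.I by push_cast; ring, norm_mul,
    Complex.norm_exp_ofReal_mul_I, mul_one, Complex.norm_real, Real.norm_eq_abs]
  unfold Kplus
  have hN : (0 : ℝ) ≤ N := Nat.cast_nonneg N
  have hp := Real.pi_pos
  rw [neg_mul, abs_neg, Int.cast_natCast, abs_of_pos (by positivity),
    show 2 / π * (1 / ((N : ℝ) + 1)) = 1 / π * (2 / ((N : ℝ) + 1)) by ring]
  gcongr 1 / π * ?_
  rw [div_le_div_iff₀ (by positivity) (by positivity)]
  linarith

/-- The Fourier multiplier of the convolution kernel `K⁺(z) = -(1/π)·1/(z+1/2)` is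
`i e^{iπξ} sin(πξ)/|sin(πξ)|`, the sum over `ℤ` being taken in the principal value
(symmetric) sense. -/
theorem dft_Kplus (ξ : ℝ) (hξ : ξ ∈ Set.Ioo (-(1:ℝ)/2) (1/2)) (hξ0 : ξ ≠ 0) :
    Tendsto
      (fun N : ℕ => ∑ y ∈ Finset.Icc (-(N : ℤ)) (N : ℤ),
        (Kplus y : ℂ) * Complex.exp (-(2 * (π : ℂ) * Complex.I * (y : ℂ) * (ξ : ℂ))))
      atTop (nhds (mplus ξ)) := by
  have hp := Real.pi_pos
  obtain ⟨hl, hr⟩ := hξ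
  have hsq := aux_square (π * ξ) (mul_ne_zero hp.ne' hξ0) (by nlinarith) (by nlinarith)
  have h1 := ((Complex.continuous_ofReal.tendsto _).comp hsq).const_mul
    (4 / π * Complex.I * Complex.exp ((π : ℂ) * (ξ : ℂ) * Complex.I))
  have h2 := h1.add (aux_last ξ)
  have hpc : (π : ℂ) ≠ 0 := by exact_mod_cast hp.ne'
  have hlim : (4 / π * Complex.I * Complex.exp ((π : ℂ) * (ξ : ℂ) * Complex.I)) *
      ((π / 4 * (Real.sin (π * ξ) / |Real.sin (π * ξ)|) : ℝ) : ℂ) + 0 = mplus ξ := by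
    unfold mplus
    rw [Complex.ofReal_mul, add_zero, Complex.ofReal_div π 4]
    generalize ((Real.sin (π * ξ) / |Real.sin (π * ξ)| : ℝ) : ℂ) = s
    push_cast
    field_simp
  rw [hlim] at h2
  refine h2.congr fun N => ?_
  rw [aux_Icc]
  congr 1
  simp only [Function.comp]
  rw [Complex.ofReal_sum, Finset.mul_sum]
  exact Finset.sum_congr rfl fun n _ => (aux_pair ξ n).symm
end
end

section
/- Weak formulation of the centered discrete Hilbert transform: for f, g ∈ ℓ²(ℤ) with Poisson extensions u^f, u^g, one has (𝓗f, g)_{ℓ²(ℤ)} = ∫₀^∞ Σ_{x∈ℤ} [ −∂⁻_x u^f · ∂_y u^g + ∂_y u^f · ∂⁺_x u^g − ∂⁺_x u^f · ∂_y u^g + ∂_y u^f · ∂⁻_x u^g ](y,x) · y dy; equivalently (𝓗f,g) = ∫₀^∞ (A ∇ u^f, ∇ u^g) y dy with ∇ = (∂_y, ∂⁺_x, ∂_y, ∂⁻_x)ᵀ and A the 4×4 matrix with rows (0,0,0,−1), (0,0,1,0), (0,−1,0,0), (1,0,0,0). -/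
open scoped Real
open MeasureTheory

noncomputable section

/-- Discrete Fourier transform of a sequence. -/
def dft (f : ℤ → ℂ) (ξ : ℝ) : ℂ :=
  ∑' x : ℤ, f x * Complex.exp (-(2 * (π : ℂ) * Complex.I * (x : ℂ) * (ξ : ℂ)))

/-- The semidiscrete Poisson extension `(P_y f)(x)` of `f : ℤ → ℂ`, where
`P_y = e^{-yA}` and `A = √(-Δ)` is the Fourier multiplier `2|sin(πξ)|`. -/
def poisson (f : ℤ → ℂ) (y : ℝ) (x : ℤ) : ℂ :=
  ∫ ξ in (-(1:ℝ)/2)..(1/2),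
    dft f ξ * Complex.exp (((-(2 * |Real.sin (π * ξ)| * y)) : ℝ) : ℂ) *
      Complex.exp (2 * (π : ℂ) * Complex.I * (x : ℂ) * (ξ : ℂ))

/-- Kernel of the centered discrete Hilbert transform `𝓗 = (𝓗⁺+𝓗⁻)/2`:
the average of the kernels `-(1/π)/(z ± 1/2)` of `𝓗±`. -/
def Kcent (z : ℤ) : ℝ :=
  (-(1 / π) * (1 / ((z : ℝ) + 1 / 2)) + -(1 / π) * (1 / ((z : ℝ) - 1 / 2))) / 2

/-- The centered discrete Hilbert transform `𝓗 = (𝓗⁺+𝓗⁻)/2` (the Fourier multiplier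
operator with symbol `i cos(πξ) sin(πξ)/|sin(πξ)|`), realized as convolution. -/
def Hcent (f : ℤ → ℂ) : ℤ → ℂ := fun x => ∑' z : ℤ, (Kcent z : ℂ) * f (x - z)


/-- Inverse transform. -/
def co (φ : ℝ → ℂ) (x : ℤ) : ℂ :=
  ∫ ξ in (-(1:ℝ)/2)..(1/2), φ ξ * Complex.exp (2 * (π : ℂ) * Complex.I * (x : ℂ) * (ξ : ℂ))

lemma fourierCoeff_lift (φ : ℝ → ℂ) (hp : Function.Periodic φ 1) (n : ℤ) :
    fourierCoeff (T := 1) (hp.lift : AddCircle (1:ℝ) → ℂ) n = co φ (-n) := by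
  rw [fourierCoeff_eq_intervalIntegral _ n (-(1:ℝ)/2), co]
  have h : -(1:ℝ)/2 + 1 = 1/2 := by norm_num
  rw [h, one_div_one, one_smul]
  refine intervalIntegral.integral_congr fun ξ _ => ?_
  change fourier (-n) (ξ : AddCircle (1:ℝ)) * (hp.lift (ξ : AddCircle (1:ℝ))) = _
  rw [Function.Periodic.lift_coe]
  have := @fourier_coe_apply (1:ℝ) (-n) ξ
  rw [this, mul_comm]
  congr 2
  push_cast
  ring

lemma integral_lift (h : AddCircle (1:ℝ) → ℂ) :
    ∫ t, h t ∂AddCircle.haarAddCircle = ∫ ξ in (-(1:ℝ)/2)..(1/2), h ξ := by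
  rw [AddCircle.integral_haarAddCircle, ← AddCircle.intervalIntegral_preimage 1 (-(1:ℝ)/2)]
  norm_num

lemma parseval (φ ψ : ℝ → ℂ) (hφ : Continuous φ) (hψ : Continuous ψ)
    (pφ : Function.Periodic φ 1) (pψ : Function.Periodic ψ 1) :
    HasSum (fun x : ℤ => co φ x * co ψ x) (∫ ξ in (-(1:ℝ)/2)..(1/2), φ ξ * ψ (-ξ)) := by
  have p1 : Function.Periodic (fun ξ => (starRingEnd ℂ) (φ ξ)) 1 := fun ξ => by simp [pφ ξ]
  have p2 : Function.Periodic (fun ξ => ψ (-ξ)) 1 := fun ξ => by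
    have := pψ (-(ξ+1)); simp at this ⊢; rw [← this]
  have c1 : Continuous (p1.lift : AddCircle (1:ℝ) → ℂ) :=
    continuous_coinduced_dom.mpr (Complex.continuous_conj.comp hφ)
  have c2 : Continuous (p2.lift : AddCircle (1:ℝ) → ℂ) :=
    continuous_coinduced_dom.mpr (hψ.comp continuous_neg)
  let X : C(AddCircle (1:ℝ), ℂ) := ⟨_, c1⟩
  let Y : C(AddCircle (1:ℝ), ℂ) := ⟨_, c2⟩
  have key := (fourierBasis (T := (1:ℝ))).hasSum_inner_mul_inner
    (ContinuousMap.toLp (E := ℂ) 2 AddCircle.haarAddCircle ℂ X)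
    (ContinuousMap.toLp (E := ℂ) 2 AddCircle.haarAddCircle ℂ Y)
  rw [ContinuousMap.inner_toLp, integral_lift] at key
  have e1 : ∀ i : ℤ, co (fun ξ => ψ (-ξ)) (-i) = co ψ i := by
    intro i
    have := intervalIntegral.integral_comp_neg (a := -(1:ℝ)/2) (b := 1/2)
      (fun ξ => ψ ξ * Complex.exp (2 * (π : ℂ) * Complex.I * (i : ℂ) * (ξ : ℂ)))
    have h : -(-(1:ℝ)/2) = 1/2 := by norm_num
    have h' : -(1/2:ℝ) = -1/2 := by norm_num
    rw [h, h'] at this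
    rw [co, co, ← this]
    simp
  have e2 : ∀ i : ℤ, (starRingEnd ℂ) (co (fun ξ => (starRingEnd ℂ) (φ ξ)) (-i)) = co φ i := by
    intro i
    rw [co, co, intervalIntegral.intervalIntegral_eq_integral_uIoc,
      intervalIntegral.intervalIntegral_eq_integral_uIoc]
    simp only [Complex.real_smul, map_mul, ← integral_conj]
    congr 1
    · split_ifs <;> simp
    · congr 1
      ext ξ
      rw [← Complex.exp_conj]
      simp [Complex.conj_ofNat]
  convert! key using 1
  · ext i
    rw [← inner_conj_symm, ← HilbertBasis.repr_apply_apply, ← HilbertBasis.repr_apply_apply,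
      fourierBasis_repr, fourierBasis_repr, fourierCoeff_toLp, fourierCoeff_toLp]
    change _ = (starRingEnd ℂ) (fourierCoeff p1.lift i) * (fourierCoeff p2.lift i)
    rw [fourierCoeff_lift, fourierCoeff_lift, e1, e2]
  · refine intervalIntegral.integral_congr fun ξ _ => ?_
    change _ = (p2.lift (ξ : AddCircle (1:ℝ))) * (starRingEnd ℂ) (p1.lift (ξ : AddCircle (1:ℝ)))
    simp [Function.Periodic.lift_coe, mul_comm]

lemma norm_e (t : ℝ) (z : ℂ) (h : z = (t:ℂ) * Complex.I) : ‖Complex.exp z‖ = 1 := by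
  rw [h, Complex.norm_exp_ofReal_mul_I]

lemma norm_ek (x : ℤ) (ξ : ℝ) :
    ‖Complex.exp (-(2 * (π : ℂ) * Complex.I * (x : ℂ) * (ξ : ℂ)))‖ = 1 := by
  apply norm_e (-(2 * π * x * ξ)); push_cast; ring

lemma norm_ek' (x : ℤ) (ξ : ℝ) :
    ‖Complex.exp ((2 * (π : ℂ) * Complex.I * (x : ℂ) * (ξ : ℂ)))‖ = 1 := by
  apply norm_e ((2 * π * x * ξ)); push_cast; ring

lemma dft_cont (f : ℤ → ℂ) (hf : Summable fun x => ‖f x‖) : Continuous (dft f) := by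
  unfold dft
  refine continuous_tsum (fun x => by fun_prop) hf fun x ξ => ?_
  rw [norm_mul, norm_ek, mul_one]

lemma dft_hasSum (f : ℤ → ℂ) (hf : Summable fun x => ‖f x‖) (ξ : ℝ) :
    HasSum (fun x : ℤ => f x * Complex.exp (-(2 * (π : ℂ) * Complex.I * (x : ℂ) * (ξ : ℂ))))
      (dft f ξ) := by
  refine Summable.hasSum (Summable.of_norm ?_)
  simpa [norm_mul, norm_ek] using hf

lemma dft_bound (f : ℤ → ℂ) (hf : Summable fun x => ‖f x‖) (ξ : ℝ) :
    ‖dft f ξ‖ ≤ ∑' x, ‖f x‖ := by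
  refine (norm_tsum_le_tsum_norm ?_).trans ?_
  · simpa [norm_mul, norm_ek] using hf
  · simp [norm_ek]

lemma dft_per (f : ℤ → ℂ) : Function.Periodic (dft f) 1 := by
  intro ξ
  unfold dft
  congr 1; ext x; congr 1
  rw [Complex.exp_eq_exp_iff_exists_int]
  exact ⟨-x, by push_cast; ring⟩

/-- exchange of sum and integral -/
lemma exch (h : ℤ → ℂ) (hh : Summable fun x => ‖h x‖) (ε : ℝ) (G : ℝ → ℂ) (hG : Measurable G)
    (C : ℝ) (hC : ∀ ξ, ‖G ξ‖ ≤ C) :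
    HasSum (fun x : ℤ => h x * ∫ ξ in (-(1:ℝ)/2)..(1/2),
        G ξ * Complex.exp (-(2 * (π : ℂ) * Complex.I * (x : ℂ) * ((ε * ξ : ℝ) : ℂ))))
      (∫ ξ in (-(1:ℝ)/2)..(1/2), G ξ * dft h (ε * ξ)) := by
  simp_rw [← intervalIntegral.integral_const_mul]
  apply intervalIntegral.hasSum_integral_of_dominated_convergence (fun x _ => ‖h x‖ * C)
  · intro x
    apply Measurable.aestronglyMeasurable
    fun_prop
  · intro x
    refine .of_forall fun ξ _ => ?_
    rw [norm_mul, norm_mul, norm_ek, mul_one]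
    gcongr
    exact hC ξ
  · exact .of_forall fun ξ _ => hh.mul_right C
  · simp
  · refine .of_forall fun ξ _ => ?_
    convert! (dft_hasSum h hh (ε * ξ)).mul_left (G ξ) using 1
    ext x
    ring

/-- the symbol -/
def msym (ξ : ℝ) : ℂ :=
  Complex.I * ((Real.cos (π * ξ) * (Real.sin (π * ξ) / |Real.sin (π * ξ)|) : ℝ) : ℂ)

lemma msym_meas : Measurable msym := by unfold msym; fun_prop

lemma msym_bound (ξ : ℝ) : ‖msym ξ‖ ≤ 1 := by
  unfold msym
  rw [norm_mul, Complex.norm_I, one_mul, Complex.norm_real, norm_mul, Real.norm_eq_abs,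
    Real.norm_eq_abs, abs_div, abs_abs]
  exact mul_le_one₀ (Real.abs_cos_le_one _) (by positivity) (div_self_le_one _)

lemma msym_neg (ξ : ℝ) : msym (-ξ) = - msym ξ := by
  unfold msym
  simp
  ring

lemma msym_pos (ξ : ℝ) (h : 0 < ξ) (h' : ξ ≤ 1/2) : msym ξ = Complex.I * Real.cos (π * ξ) := by
  unfold msym
  have : 0 < Real.sin (π * ξ) := Real.sin_pos_of_pos_of_lt_pi (by positivity) (by
    nlinarith [Real.pi_pos])
  rw [abs_of_pos this, div_self this.ne', mul_one]

lemma integral_sin_half (a : ℝ) (ha : a ≠ 0) (hc : Real.cos (a * (1/2)) = 0) :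
    ∫ ξ in (0:ℝ)..(1/2), Real.sin (a * ξ) = 1 / a := by
  rw [intervalIntegral.integral_comp_mul_left _ ha, integral_sin, hc]
  simp

lemma K_eq (z : ℤ) : co msym z = (Kcent z : ℂ) := by
  have hi : ∀ a b : ℝ, IntervalIntegrable (fun ξ : ℝ => msym ξ * Complex.exp (2 * (π : ℂ) * Complex.I * (z : ℂ) * (ξ : ℂ))) volume a b := by
    intro a b
    refine (intervalIntegrable_const (c := (1:ℝ))).mono_fun ?_ ?_
    · have := msym_meas
      apply Measurable.aestronglyMeasurable
      fun_prop
    · refine .of_forall fun ξ => ?_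
      simp only [norm_mul, norm_ek', mul_one, norm_one]
      exact msym_bound ξ
  have h1 := intervalIntegral.integral_comp_neg (a := 0) (b := 1/2)
      (fun ξ => msym ξ * Complex.exp (2 * (π : ℂ) * Complex.I * (z : ℂ) * (ξ : ℂ)))
  have h' : -(1/2:ℝ) = -1/2 := by norm_num
  rw [h', neg_zero] at h1
  have hi2 : IntervalIntegrable (fun ξ : ℝ => msym (-ξ) * Complex.exp (2 * (π : ℂ) * Complex.I * (z : ℂ) * ((-ξ : ℝ) : ℂ))) volume 0 (1/2) := by
    refine (intervalIntegrable_const (c := (1:ℝ))).mono_fun ?_ ?_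
    · have := msym_meas
      apply Measurable.aestronglyMeasurable
      fun_prop
    · refine .of_forall fun ξ => ?_
      simp only [norm_mul, norm_ek', mul_one, norm_one]
      exact msym_bound _
  rw [co, ← intervalIntegral.integral_add_adjacent_intervals (hi _ 0) (hi 0 _), ← h1,
    ← intervalIntegral.integral_add hi2 (hi _ _)]
  have h2 : ∀ ξ ∈ Set.uIoc (0:ℝ) (1/2), msym (-ξ) * Complex.exp (2 * (π : ℂ) * Complex.I * (z : ℂ) * ((-ξ : ℝ) : ℂ)) + msym ξ * Complex.exp (2 * (π : ℂ) * Complex.I * (z : ℂ) * (ξ : ℂ))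
     = ((-(Real.sin (((2 * z + 1) * π) * ξ) + Real.sin (((2 * z - 1) * π) * ξ)) : ℝ) : ℂ) := by
    intro ξ hξ
    rw [Set.uIoc_of_le (by norm_num)] at hξ
    rw [msym_neg, msym_pos ξ hξ.1 hξ.2]
    have e1 : (2 * (π : ℂ) * Complex.I * (z : ℂ) * ((-ξ : ℝ) : ℂ)) = ((-(2 * z * π * ξ) : ℝ) : ℂ) * Complex.I := by push_cast; ring
    have e2 : (2 * (π : ℂ) * Complex.I * (z : ℂ) * ((ξ : ℝ) : ℂ)) = (((2 * z * π * ξ) : ℝ) : ℂ) * Complex.I := by push_cast; ring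
    have e3 : ((2 * z + 1) * π) * ξ = 2 * z * π * ξ + π * ξ := by ring
    have e4 : ((2 * z - 1) * π) * ξ = 2 * z * π * ξ - π * ξ := by ring
    rw [e1, e2, Complex.exp_mul_I, Complex.exp_mul_I, ← Complex.ofReal_cos, ← Complex.ofReal_sin,
      ← Complex.ofReal_cos, ← Complex.ofReal_sin, e3, e4, Real.sin_add, Real.sin_sub, Real.cos_neg,
      Real.sin_neg]
    push_cast
    linear_combination (2 * Complex.cos (π * ξ) * Complex.sin (2 * z * π * ξ)) * Complex.I_sq
  rw [intervalIntegral.integral_congr_ae (.of_forall h2), intervalIntegral.integral_ofReal,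
    intervalIntegral.integral_neg, intervalIntegral.integral_add
      (Continuous.intervalIntegrable (by fun_prop) _ _)
      (Continuous.intervalIntegrable (by fun_prop) _ _)]
  have n1 : (2 * z + 1 : ℝ) ≠ 0 := by
    have : (2 * z + 1 : ℤ) ≠ 0 := by omega
    exact_mod_cast this
  have n2 : (2 * z - 1 : ℝ) ≠ 0 := by
    have : (2 * z - 1 : ℤ) ≠ 0 := by omega
    exact_mod_cast this
  rw [integral_sin_half _ (mul_ne_zero n1 Real.pi_ne_zero),
    integral_sin_half _ (mul_ne_zero n2 Real.pi_ne_zero)]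
  · congr 1
    unfold Kcent
    have n3 : (z + 1/2 : ℝ) ≠ 0 := by intro h; apply n1; linarith
    have n4 : (z - 1/2 : ℝ) ≠ 0 := by intro h; apply n2; linarith
    have := Real.pi_ne_zero
    have q1 : (2 * z + 1 : ℝ) = 2 * (z + 1/2) := by ring
    have q2 : (2 * z - 1 : ℝ) = 2 * (z - 1/2) := by ring
    rw [q1, q2]
    generalize (z + 1/2 : ℝ) = A at *
    generalize (z - 1/2 : ℝ) = B at *
    field_simp
    ring
  · rw [Real.cos_eq_zero_iff]
    exact ⟨z - 1, by push_cast; ring⟩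
  · rw [Real.cos_eq_zero_iff]
    exact ⟨z, by ring⟩

lemma Hcent_eq (f : ℤ → ℂ) (hf : Summable fun x => ‖f x‖) (x : ℤ) :
    Hcent f x = co (fun ξ => msym ξ * dft f ξ) x := by
  have hm := msym_meas
  have key := exch f hf 1
    (fun ξ => msym ξ * Complex.exp (2 * (π : ℂ) * Complex.I * (x : ℂ) * (ξ : ℂ)))
    (by fun_prop) 1 (fun ξ => by rw [norm_mul, norm_ek', mul_one]; exact msym_bound ξ)
  unfold Hcent
  rw [← (Equiv.subLeft x).tsum_eq]
  have e : ∀ w : ℤ, (Kcent ((Equiv.subLeft x) w) : ℂ) * f (x - (Equiv.subLeft x) w) =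
      f w * ∫ ξ in (-(1:ℝ)/2)..(1/2),
        (msym ξ * Complex.exp (2 * (π : ℂ) * Complex.I * (x : ℂ) * (ξ : ℂ))) *
          Complex.exp (-(2 * (π : ℂ) * Complex.I * (w : ℂ) * ((1 * ξ : ℝ) : ℂ))) := by
    intro w
    rw [Equiv.subLeft_apply, sub_sub_cancel, ← K_eq, mul_comm, co]
    congr 1
    refine intervalIntegral.integral_congr fun ξ _ => ?_
    rw [mul_assoc (msym ξ), ← Complex.exp_add]
    congr 2
    push_cast
    ring
  simp_rw [e]
  rw [key.tsum_eq, co]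
  refine intervalIntegral.integral_congr fun ξ _ => ?_
  simp only [one_mul]
  ring

lemma lhs_eq (f g : ℤ → ℂ) (hf : Summable fun x => ‖f x‖) (hg : Summable fun x => ‖g x‖) :
    ∑' x : ℤ, Hcent f x * g x =
      ∫ ξ in (-(1:ℝ)/2)..(1/2), msym ξ * dft f ξ * dft g (-ξ) := by
  have hm := msym_meas
  have hc := (dft_cont f hf).measurable
  have key := exch g hg (-1) (fun ξ => msym ξ * dft f ξ) (by fun_prop) (∑' x, ‖f x‖)
    (fun ξ => by
      rw [norm_mul, ← one_mul (∑' x, ‖f x‖)]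
      exact mul_le_mul (msym_bound ξ) (dft_bound f hf ξ) (norm_nonneg _) zero_le_one)
  simp_rw [Hcent_eq f hf, co]
  simp only [neg_mul, one_mul] at key
  rw [← key.tsum_eq]
  congr 1
  ext x
  rw [mul_comm]
  congr 1
  refine intervalIntegral.integral_congr fun ξ _ => ?_
  simp

/-- Fourier side of the Poisson extension. -/
def pe (f : ℤ → ℂ) (y ξ : ℝ) : ℂ :=
  dft f ξ * Complex.exp (((-(2 * |Real.sin (π * ξ)| * y)) : ℝ) : ℂ)

lemma pe_cont (f : ℤ → ℂ) (hf : Summable fun x => ‖f x‖) (y : ℝ) : Continuous (pe f y) := by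
  have := dft_cont f hf
  unfold pe
  fun_prop

lemma abs_sin_per (ξ : ℝ) : |Real.sin (π * (ξ + 1))| = |Real.sin (π * ξ)| := by
  rw [mul_add, mul_one, Real.sin_add_pi, abs_neg]

lemma pe_per (f : ℤ → ℂ) (y : ℝ) : Function.Periodic (pe f y) 1 := by
  intro ξ
  unfold pe
  rw [abs_sin_per, dft_per]

lemma poisson_eq (f : ℤ → ℂ) (y : ℝ) (x : ℤ) : poisson f y x = co (pe f y) x := rfl

lemma poisson_deriv (f : ℤ → ℂ) (hf : Summable fun x => ‖f x‖) (y : ℝ) (x : ℤ) :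
    deriv (fun t => poisson f t x) y =
      co (fun ξ => ((-(2 * |Real.sin (π * ξ)|) : ℝ) : ℂ) * pe f y ξ) x := by
  have hc := dft_cont f hf
  refine HasDerivAt.deriv ?_
  refine (intervalIntegral.hasDerivAt_integral_of_dominated_loc_of_deriv_le
    (s := Metric.ball y 1)
    (F := fun t ξ => pe f t ξ * Complex.exp (2 * (π : ℂ) * Complex.I * (x : ℂ) * (ξ : ℂ)))
    (F' := fun t ξ => ((-(2 * |Real.sin (π * ξ)|) : ℝ) : ℂ) * pe f t ξ *
      Complex.exp (2 * (π : ℂ) * Complex.I * (x : ℂ) * (ξ : ℂ)))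
    (bound := fun _ => 2 * ((∑' x, ‖f x‖) * Real.exp (2 * (|y| + 1))))
    (Metric.ball_mem_nhds y one_pos) ?_ ?_ ?_ ?_ ?_ ?_).2
  · refine .of_forall fun t => ?_
    have := pe_cont f hf t
    apply Continuous.aestronglyMeasurable
    fun_prop
  · have := pe_cont f hf y
    apply Continuous.intervalIntegrable
    fun_prop
  · have := pe_cont f hf y
    apply Continuous.aestronglyMeasurable
    fun_prop
  · refine .of_forall fun ξ _ t ht => ?_
    rw [norm_mul, norm_ek', mul_one, norm_mul, pe, norm_mul, Complex.norm_exp_ofReal,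
      Complex.norm_real, norm_neg, Real.norm_eq_abs, abs_mul, abs_abs, abs_two]
    have hs := Real.abs_sin_le_one (π * ξ)
    have ht' : |t| ≤ |y| + 1 := by
      rw [Metric.mem_ball, Real.dist_eq] at ht
      have := abs_sub_abs_le_abs_sub t y
      linarith
    have h3 : -(2 * |Real.sin (π * ξ)| * t) ≤ 2 * (|y| + 1) := by
      have h4 : |Real.sin (π * ξ)| * (-t) ≤ 1 * (|y| + 1) := by
        calc _ ≤ |Real.sin (π * ξ)| * (|y| + 1) := by
              gcongr; exact (neg_le_abs t).trans ht'
          _ ≤ _ := by gcongr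
      linarith
    refine mul_le_mul (by linarith) ?_ (by positivity) (by norm_num)
    exact mul_le_mul (dft_bound f hf ξ) (Real.exp_le_exp.2 h3) (by positivity)
      (tsum_nonneg fun _ => norm_nonneg _)
  · simp
  · refine .of_forall fun ξ _ t _ => ?_
    refine HasDerivAt.mul_const ?_ _
    unfold pe
    have h1 : HasDerivAt (fun t : ℝ => ((-(2 * |Real.sin (π * ξ)| * t) : ℝ) : ℂ))
        ((-(2 * |Real.sin (π * ξ)|) : ℝ) : ℂ) t := by
      apply HasDerivAt.ofReal_comp
      have h0 := ((hasDerivAt_id t).const_mul (2 * |Real.sin (π * ξ)|)).neg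
      rw [mul_one] at h0
      exact h0
    have h2 := (h1.cexp).const_mul (dft f ξ)
    convert! h2 using 1
    ring

lemma co_shift (φ : ℝ → ℂ) (hφ : Continuous φ) (x : ℤ) :
    co φ (x + 1) - co φ (x - 1) =
      co (fun ξ => (2 * Complex.I * ((Real.sin (2 * π * ξ) : ℝ) : ℂ)) * φ ξ) x := by
  unfold co
  rw [← intervalIntegral.integral_sub (Continuous.intervalIntegrable (by fun_prop) _ _)
    (Continuous.intervalIntegrable (by fun_prop) _ _)]
  refine intervalIntegral.integral_congr fun ξ _ => ?_
  simp only
  have e1 : 2 * (π : ℂ) * Complex.I * ((x + 1 : ℤ) : ℂ) * (ξ : ℂ) =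
    2 * (π : ℂ) * Complex.I * (x : ℂ) * (ξ : ℂ) + ((2 * π * ξ : ℝ) : ℂ) * Complex.I := by
    push_cast; ring
  have e2 : 2 * (π : ℂ) * Complex.I * ((x - 1 : ℤ) : ℂ) * (ξ : ℂ) =
    2 * (π : ℂ) * Complex.I * (x : ℂ) * (ξ : ℂ) + ((-(2 * π * ξ) : ℝ) : ℂ) * Complex.I := by
    push_cast; ring
  rw [e1, e2, Complex.exp_add, Complex.exp_add, Complex.exp_mul_I, Complex.exp_mul_I,
    ← Complex.ofReal_cos, ← Complex.ofReal_sin,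
      ← Complex.ofReal_cos, ← Complex.ofReal_sin, Real.cos_neg, Real.sin_neg]
  push_cast
  ring

/-- The kernel after Parseval. -/
def ker (f g : ℤ → ℂ) (ξ y : ℝ) : ℂ :=
  dft f ξ * dft g (-ξ) * (Complex.I * ((16 * (Real.sin (π * ξ) * |Real.sin (π * ξ)| *
    Real.cos (π * ξ)) : ℝ) : ℂ)) * ((y * Real.exp (-(4 * |Real.sin (π * ξ)| * y)) : ℝ) : ℂ)

lemma rhs_sum (f g : ℤ → ℂ) (hf : Summable fun x => ‖f x‖) (hg : Summable fun x => ‖g x‖)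
    (y : ℝ) : (∑' x : ℤ,
          (-(poisson f y x - poisson f y (x - 1)) * deriv (fun t => poisson g t x) y +
            deriv (fun t => poisson f t x) y * (poisson g y (x + 1) - poisson g y x) +
            -(poisson f y (x + 1) - poisson f y x) * deriv (fun t => poisson g t x) y +
            deriv (fun t => poisson f t x) y * (poisson g y x - poisson g y (x - 1))))
          * (y : ℂ) = ∫ ξ in (-(1:ℝ)/2)..(1/2), ker f g ξ y := by
  have cf := pe_cont f hf y
  have cg := pe_cont g hg y
  have sp : ∀ ξ : ℝ, Real.sin (2 * π * (ξ + 1)) = Real.sin (2 * π * ξ) := fun ξ => by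
    rw [mul_add, mul_one, Real.sin_add_two_pi]
  have hp1 : ∀ f : ℤ → ℂ, Function.Periodic
      (fun ξ => (2 * Complex.I * ((Real.sin (2 * π * ξ) : ℝ) : ℂ)) * pe f y ξ) 1 := by
    intro f ξ
    simp only [sp, pe_per f y ξ]
  have hp2 : ∀ f : ℤ → ℂ, Function.Periodic
      (fun ξ => ((-(2 * |Real.sin (π * ξ)|) : ℝ) : ℂ) * pe f y ξ) 1 := by
    intro f ξ
    simp only [abs_sin_per, pe_per f y ξ]
  have P1 := parseval _ _ (by fun_prop) (by fun_prop) (hp1 f) (hp2 g)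
  have P2 := parseval _ _ (by fun_prop) (by fun_prop) (hp2 f) (hp1 g)
  have P := P2.sub P1
  simp_rw [← co_shift _ cf, ← co_shift _ cg, ← poisson_deriv f hf, ← poisson_deriv g hg] at P
  rw [← intervalIntegral.integral_sub (Continuous.intervalIntegrable (by fun_prop) _ _)
    (Continuous.intervalIntegrable (by fun_prop) _ _)] at P
  simp only [poisson_eq] at P ⊢
  have e : ∀ x : ℤ, (-(co (pe f y) x - co (pe f y) (x - 1)) * deriv (fun t => co (pe g t) x) y +
            deriv (fun t => co (pe f t) x) y * (co (pe g y) (x + 1) - co (pe g y) x) +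
            -(co (pe f y) (x + 1) - co (pe f y) x) * deriv (fun t => co (pe g t) x) y +
            deriv (fun t => co (pe f t) x) y * (co (pe g y) x - co (pe g y) (x - 1))) =
     deriv (fun t => co (pe f t) x) y * (co (pe g y) (x + 1) - co (pe g y) (x - 1)) -
      (co (pe f y) (x + 1) - co (pe f y) (x - 1)) * deriv (fun t => co (pe g t) x) y := by
    intro x; ring
  simp_rw [e]
  rw [P.tsum_eq, ← intervalIntegral.integral_mul_const]
  refine intervalIntegral.integral_congr fun ξ _ => ?_
  simp only [pe, ker, mul_neg, Real.sin_neg, abs_neg]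
  have e4 : Real.exp (-(4 * |Real.sin (π * ξ)| * y)) =
    Real.exp (-(2 * |Real.sin (π * ξ)| * y)) * Real.exp (-(2 * |Real.sin (π * ξ)| * y)) := by
    rw [← Real.exp_add]; congr 1; ring
  have e5 : Real.sin (2 * π * ξ) = 2 * Real.sin (π * ξ) * Real.cos (π * ξ) := by
    rw [← Real.sin_two_mul]; congr 1; ring
  rw [e4, e5, ← Complex.ofReal_exp]
  push_cast
  ring

lemma int_gamma (r : ℝ) (hr : 0 < r) :
    ∫ t in Set.Ioi (0:ℝ), t * Real.exp (-(r * t)) = (1 / r) ^ 2 := by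
  have h := Real.integral_rpow_mul_exp_neg_mul_Ioi (a := 2) two_pos hr
  rw [show (2:ℝ) - 1 = 1 by norm_num] at h
  simp only [Real.rpow_one, Real.Gamma_two, mul_one, Real.rpow_two] at h
  exact h

lemma ker_integrable (f g : ℤ → ℂ) (ξ : ℝ) :
    IntegrableOn (fun y => ker f g ξ y) (Set.Ioi 0) := by
  unfold ker
  by_cases hs : Real.sin (π * ξ) = 0
  · simp [hs]
  · refine Integrable.const_mul (Integrable.ofReal ?_) _
    refine .of_integral_ne_zero ?_
    have hp : 0 < 4 * |Real.sin (π * ξ)| := by positivity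
    have h := int_gamma _ hp
    refine ne_of_eq_of_ne h ?_
    positivity

lemma ker_integral (f g : ℤ → ℂ) (ξ : ℝ) :
    ∫ y in Set.Ioi (0:ℝ), ker f g ξ y = msym ξ * dft f ξ * dft g (-ξ) := by
  unfold ker msym
  by_cases hs : Real.sin (π * ξ) = 0
  · simp [hs]
  · rw [integral_const_mul, integral_complex_ofReal, int_gamma _ (by positivity)]
    have : (16 * (Real.sin (π * ξ) * |Real.sin (π * ξ)| * Real.cos (π * ξ))) *
      (1 / (4 * |Real.sin (π * ξ)|)) ^ 2 =
      Real.cos (π * ξ) * (Real.sin (π * ξ) / |Real.sin (π * ξ)|) := by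
      have := abs_ne_zero.2 hs
      field_simp
      ring
    rw [← this]
    push_cast
    ring

lemma ker_integral_norm (f g : ℤ → ℂ) (ξ : ℝ) :
    ∫ y in Set.Ioi (0:ℝ), ‖ker f g ξ y‖ = ‖msym ξ * dft f ξ * dft g (-ξ)‖ := by
  rw [← ker_integral]
  unfold ker
  have h0 : 0 ≤ ∫ y in Set.Ioi (0:ℝ), y * Real.exp (-(4 * |Real.sin (π * ξ)| * y)) := by
    refine setIntegral_nonneg measurableSet_Ioi fun y hy => ?_
    have : (0:ℝ) < y := hy
    positivity
  rw [integral_const_mul, norm_mul, integral_complex_ofReal, Complex.norm_real, Real.norm_eq_abs,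
    abs_of_nonneg h0, ← integral_const_mul]
  · refine setIntegral_congr_fun measurableSet_Ioi fun y hy => ?_
    have : (0:ℝ) < y := hy
    have h1 : 0 ≤ y * Real.exp (-(4 * |Real.sin (π * ξ)| * y)) := by positivity
    rw [norm_mul, Complex.norm_real, Real.norm_eq_abs, abs_of_nonneg h1]

/-- Weak formulation of the centered discrete Hilbert transform:
`(𝓗f, g) = ∫₀^∞ Σ_x [ -∂⁻_x u^f ∂_y u^g + ∂_y u^f ∂⁺_x u^g
                      - ∂⁺_x u^f ∂_y u^g + ∂_y u^f ∂⁻_x u^g ] y dy`,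
equivalently `(𝓗f,g) = ∫₀^∞ (A ∇u^f, ∇u^g) y dy` with `∇ = (∂_y, ∂⁺_x, ∂_y, ∂⁻_x)ᵀ`
and `A` the orthogonal matrix with rows `(0,0,0,-1), (0,0,1,0), (0,-1,0,0), (1,0,0,0)`. -/
theorem weak_formulation_Hcent (f g : ℤ → ℂ)
    (hf : Summable fun x => ‖f x‖) (hg : Summable fun x => ‖g x‖) :
    ∑' x : ℤ, Hcent f x * g x =
      ∫ y in Set.Ioi (0 : ℝ),
        (∑' x : ℤ,
          (-(poisson f y x - poisson f y (x - 1)) * deriv (fun t => poisson g t x) y +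
            deriv (fun t => poisson f t x) y * (poisson g y (x + 1) - poisson g y x) +
            -(poisson f y (x + 1) - poisson f y x) * deriv (fun t => poisson g t x) y +
            deriv (fun t => poisson f t x) y * (poisson g y x - poisson g y (x - 1))))
          * (y : ℂ) := by
  rw [lhs_eq f g hf hg]
  simp_rw [rhs_sum f g hf hg]
  have hcf := dft_cont f hf
  have hcg := dft_cont g hg
  have hm := msym_meas
  rw [← intervalIntegral_integral_swap]
  · exact intervalIntegral.integral_congr fun ξ _ => (ker_integral f g ξ).symm
  · rw [integrable_prod_iff]
    · refine ⟨.of_forall fun ξ => ker_integrable f g ξ, ?_⟩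
      simp only [Function.uncurry, ker_integral_norm]
      have : IntervalIntegrable (fun _ : ℝ => (∑' x, ‖f x‖) * (∑' x, ‖g x‖)) volume
        (-(1:ℝ)/2) (1/2) := intervalIntegrable_const
      rw [intervalIntegrable_iff] at this
      refine Integrable.mono this ?_ (.of_forall fun ξ => ?_)
      · apply Measurable.aestronglyMeasurable
        fun_prop
      · rw [norm_norm, norm_mul, norm_mul]
        refine le_trans ?_ (le_abs_self _)
        refine mul_le_mul ?_ (dft_bound g hg _) (by positivity)
          (tsum_nonneg fun _ => norm_nonneg _)
        calc _ ≤ 1 * ‖dft f ξ‖ := by gcongr; exact msym_bound ξ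
          _ ≤ _ := by rw [one_mul]; exact dft_bound f hf ξ
    · apply Continuous.aestronglyMeasurable
      unfold ker Function.uncurry
      fun_prop
end
end
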